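/- Let q be an odd positive integer with q > 1 and gcd(q, 5) = 1. Then there does not exist a regular Paley type partial difference set in any abelian group of order 25q². -/

import Mathlib

open Finset

variable {G : Type*} [CommGroup G] [Fintype G] [DecidableEq G]

/-- `D` is a `(v,k,l,m)`-partial difference set in `G`: every non-identity element of `D`
has exactly `l` representations as `d₁ * d₂⁻¹` with `d₁ ≠ d₂` in `D`, and every
non-identity element not in `D` has exactly `m` such representations. -/
def IsPDS (D : Finset G) (v k l m : ℕ) : Prop :=
  Fintype.card G = v ∧ D.card = k ∧
  (∀ g : G, g ≠ 1 → g ∈ D →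
    ((D ×ˢ D).filter (fun x => x.1 ≠ x.2 ∧ x.1 * x.2⁻¹ = g)).card = l) ∧
  (∀ g : G, g ≠ 1 → g ∉ D →
    ((D ×ˢ D).filter (fun x => x.1 ≠ x.2 ∧ x.1 * x.2⁻¹ = g)).card = m)

/-- A regular PDS: additionally `D⁽⁻¹⁾ = D` and `1 ∉ D`. -/
def IsRegularPDS (D : Finset G) (v k l m : ℕ) : Prop :=
  IsPDS D v k l m ∧ (∀ d : G, d ∈ D ↔ d⁻¹ ∈ D) ∧ (1 : G) ∉ D

/-- A regular Paley type PDS: a regular `(v, (v-1)/2, (v-5)/4, (v-1)/4)`-PDS,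
encoded without division as `v = 2k+1`, `v = 4l+5`, `v = 4m+1`. -/
def IsPaleyPDS (D : Finset G) : Prop :=
  ∃ k l m : ℕ, IsRegularPDS D (Fintype.card G) k l m ∧
    Fintype.card G = 2 * k + 1 ∧ Fintype.card G = 4 * l + 5 ∧ Fintype.card G = 4 * m + 1

lemma conv0 {G : Type*} [CommGroup G] [Fintype G] [DecidableEq G] (D : Finset G) (v k l m : ℕ) (hv : Fintype.card G = v) (hk : D.card = k)
   (h1 : ∀ g : G, g ≠ 1 → g ∈ D →
    ((D ×ˢ D).filter (fun x => x.1 ≠ x.2 ∧ x.1 * x.2⁻¹ = g)).card = l)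
   (h2 : ∀ g : G, g ≠ 1 → g ∉ D →
    ((D ×ˢ D).filter (fun x => x.1 ≠ x.2 ∧ x.1 * x.2⁻¹ = g)).card = m)
   (hs : ∀ d : G, d ∈ D ↔ d⁻¹ ∈ D) (h1D : (1 : G) ∉ D) (e1 : v = 2 * k + 1) (e2 : v = 4 * l + 5) (e3 : v = 4 * m + 1)
   (f : G → ℤ) (hf : ∀ g, f g = 2 * (if g ∈ D then 1 else 0) + (if g = 1 then 1 else 0) - 1) (g : G) :
   ∑ x, f x * f (x⁻¹ * g) = (if g = 1 then (v : ℤ) else 0) - 1 := by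
  have key : ∑ x, f x * f (x⁻¹ * g) = 4 * (∑ x : G, (if x ∈ D ∧ x⁻¹ * g ∈ D then (1 : ℤ) else 0)) + 4 * (if g ∈ D then 1 else 0) - 4 * k + (if g = 1 then 1 else 0) - 2 + v := by
    have a1 : ∑ x : G, (if x ∈ D then (1 : ℤ) else 0) = k := by simp [hk]
    have a2 : ∑ x : G, (if x⁻¹ * g ∈ D then (1 : ℤ) else 0) = k := by
      rw [← a1]
      apply Fintype.sum_equiv ((Equiv.inv G).trans (Equiv.mulRight g))
      intro x; simp
    have a3 : ∑ x : G, (if x = 1 then (1 : ℤ) else 0) = 1 := by simp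
    have a4 : ∑ x : G, (if x⁻¹ * g = 1 then (1 : ℤ) else 0) = 1 := by
      simp [inv_mul_eq_one]
    have a5 : ∑ x : G, (if x = 1 ∧ x⁻¹ * g ∈ D then (1 : ℤ) else 0) = if g ∈ D then 1 else 0 := by
      rw [Fintype.sum_eq_single 1]
      · simp
      · intro x hx; simp [hx]
    have a6 : ∑ x : G, (if x ∈ D ∧ x⁻¹ * g = 1 then (1 : ℤ) else 0) = if g ∈ D then 1 else 0 := by
      rw [Fintype.sum_eq_single g]
      · simp
      · intro x hx; simp [inv_mul_eq_one, hx]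
    have a7 : ∑ x : G, (if x = 1 ∧ x⁻¹ * g = 1 then (1 : ℤ) else 0) = if g = 1 then 1 else 0 := by
      rw [Fintype.sum_eq_single 1]
      · simp
      · intro x hx; simp [hx]
    have a8 : ∑ x : G, (1 : ℤ) = v := by simp [hv]
    have : ∀ x, f x * f (x⁻¹ * g) = 4 * (if x ∈ D ∧ x⁻¹ * g ∈ D then (1 : ℤ) else 0)
       + 2 * (if x ∈ D ∧ x⁻¹ * g = 1 then (1 : ℤ) else 0) + 2 * (if x = 1 ∧ x⁻¹ * g ∈ D then (1 : ℤ) else 0)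
       + (if x = 1 ∧ x⁻¹ * g = 1 then (1 : ℤ) else 0) - 2 * (if x ∈ D then (1 : ℤ) else 0) - 2 * (if x⁻¹ * g ∈ D then (1 : ℤ) else 0)
       - (if x = 1 then (1 : ℤ) else 0) - (if x⁻¹ * g = 1 then (1 : ℤ) else 0) + 1 := by
      intro x
      rw [hf, hf]
      simp only [ite_and]
      split_ifs <;> norm_num
    simp only [this, sum_add_distrib, sum_sub_distrib, ← mul_sum, a1, a2, a3, a4, a5, a6, a7, a8]
    ring
  rw [key]
  have hN : g ≠ 1 → ∑ x : G, (if x ∈ D ∧ x⁻¹ * g ∈ D then (1 : ℤ) else 0) = ((D ×ˢ D).filter (fun x => x.1 ≠ x.2 ∧ x.1 * x.2⁻¹ = g)).card := by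
    intro hg
    rw [sum_boole]
    norm_cast
    apply card_bij (fun x _ => (x, g⁻¹ * x))
    · intro x hx
      simp only [mem_filter, mem_univ, true_and, mem_product] at hx ⊢
      refine ⟨⟨hx.1, ?_⟩, ?_, ?_⟩
      · rw [hs]; simpa [mul_comm] using hx.2
      · intro h; apply hg; simpa using h
      · simp
    · intro x _ y _ h
      simpa using congrArg Prod.fst h
    · rintro ⟨x, y⟩ h
      simp only [mem_filter, mem_product] at h
      obtain ⟨⟨hx, hy⟩, _, h⟩ := h
      refine ⟨x, ?_, ?_⟩
      · simp only [mem_filter, mem_univ, true_and]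
        refine ⟨hx, ?_⟩
        rw [← h, hs]; simpa using hy
      · rw [← h]; simp
  by_cases hg : g = 1
  · subst hg
    have : ∑ x : G, (if x ∈ D ∧ x⁻¹ * 1 ∈ D then (1 : ℤ) else 0) = k := by
      simp [← hs, hk]
    rw [this]; simp [h1D]; omega
  · rw [hN hg]
    by_cases hgD : g ∈ D
    · rw [h1 g hg hgD]; simp [hg, hgD]; omega
    · rw [h2 g hg hgD]; simp [hg, hgD]; omega

lemma frob {H : Type*} [CommGroup H] [Fintype H] (p : ℕ) [Fact p.Prime]
    (hp : (Nat.card H).Coprime p) (c : H → ZMod p) (g : H) :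
    ((∑ x, MonoidAlgebra.single x (c x) : MonoidAlgebra (ZMod p) H) ^ p).coeff (g ^ p) = c g := by
  classical
  have : CharP (MonoidAlgebra (ZMod p) H) p :=
    charP_of_injective_algebraMap (algebraMap (ZMod p) (MonoidAlgebra (ZMod p) H)).injective p
  rw [sum_pow_char]
  simp only [MonoidAlgebra.single_pow, ZMod.pow_card]
  have hinj : ∀ x : H, x ^ p = g ^ p ↔ x = g :=
    fun x => (powCoprime hp).injective.eq_iff (a := x) (b := g)
  simp [MonoidAlgebra.coeff_sum, Finsupp.finsetSum_apply, Finsupp.single_apply, hinj]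

lemma sq_conv {H R : Type*} [CommGroup H] [Fintype H] [CommRing R] (c d : H → R) :
    (∑ x, MonoidAlgebra.single x (c x) : MonoidAlgebra R H) * (∑ x, MonoidAlgebra.single x (d x))
      = ∑ g, MonoidAlgebra.single g (∑ x, c x * d (x⁻¹ * g)) := by
  classical
  have : ∀ g : H, (MonoidAlgebra.single g (∑ x, c x * d (x⁻¹ * g)) : MonoidAlgebra R H)
      = ∑ x, MonoidAlgebra.single g (c x * d (x⁻¹ * g)) := by
    intro g
    exact map_sum (MonoidAlgebra.singleAddHom g) _ _
  simp only [this, sum_mul_sum, MonoidAlgebra.single_mul_single]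
  rw [sum_comm (f := fun g x => MonoidAlgebra.single g (c x * d (x⁻¹ * g)))]
  apply sum_congr rfl
  intro x _
  apply Fintype.sum_equiv (Equiv.mulLeft x)
  intro y
  simp

lemma mod5 {H : Type*} [CommGroup H] [Fintype H] [DecidableEq H]
    (hp : (Nat.card H).Coprime 5) (h : H → ℤ) (M : ℤ)
    (hc : ∀ g, ∑ x, h x * h (x⁻¹ * g) = if g = 1 then 25 * M else 0) (g : H) : (5 : ℤ) ∣ h g := by
  have : Fact (Nat.Prime 5) := ⟨by norm_num⟩
  have h0 := frob 5 hp (fun x => (h x : ZMod 5)) g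
  have h2 := sq_conv (fun x : H => (h x : ZMod 5)) (fun x : H => (h x : ZMod 5))
  have h3 : ∀ g : H, ∑ x : H, (h x : ZMod 5) * (h (x⁻¹ * g) : ZMod 5) = 0 := by
    intro g
    have := congrArg (Int.cast : ℤ → ZMod 5) (hc g)
    push_cast at this
    rw [this]
    have h25 : (25 : ZMod 5) = 0 := by rfl
    simp [h25]
  simp only [h3, MonoidAlgebra.single_zero, sum_const_zero] at h2
  have h5 : (∑ x, MonoidAlgebra.single x (h x : ZMod 5) : MonoidAlgebra (ZMod 5) H) ^ 5 = 0 := by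
    rw [pow_succ, pow_succ, pow_succ, pow_succ, pow_one, h2]; simp
  rw [h5] at h0
  exact (ZMod.intCast_zmod_eq_zero_iff_dvd (h g) 5).1 (by simpa using h0.symm)

lemma mult {H : Type*} [CommGroup H] [Fintype H] [DecidableEq H] (n : ℕ)
    (hn : Fintype.card H = n ^ 2) (f : H → ℤ)
    (hf : ∀ g, f g = 0 ∨ f g = 1 ∨ f g = -1)
    (hc : ∀ g, ∑ x, f x * f (x⁻¹ * g) = (if g = 1 then ((n : ℤ) ^ 2) else 0) - 1)
    (p : ℕ) (hp : p.Prime) (hp2 : 2 < p) (hpn : n.Coprime p) (g : H) : f (g ^ p) = f g := by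
  have : Fact p.Prime := ⟨hp⟩
  have hsum : ∑ x, f x = 0 := by
    have h1 : (∑ x, f x) * (∑ x, f x) = ∑ g, ∑ x, f x * f (x⁻¹ * g) := by
      rw [sum_mul_sum, sum_comm (f := fun g x => f x * f (x⁻¹ * g))]
      apply sum_congr rfl
      intro x _
      apply Fintype.sum_equiv (Equiv.mulLeft x)
      intro y
      simp
    simp only [hc, sum_sub_distrib] at h1
    simp [hn] at h1
    exact h1
  set F : MonoidAlgebra (ZMod p) H := ∑ x, MonoidAlgebra.single x (f x : ZMod p) with hF
  have hcop : (Nat.card H).Coprime p := by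
    rw [Nat.card_eq_fintype_card, hn]; exact hpn.pow_left 2
  have h0 := frob p hcop (fun x => (f x : ZMod p)) g
  have h2 := sq_conv (fun x : H => (f x : ZMod p)) (fun x : H => (f x : ZMod p))
  have h3 : ∀ g : H, ∑ x : H, (f x : ZMod p) * (f (x⁻¹ * g) : ZMod p)
      = (if g = 1 then ((n : ZMod p) ^ 2) else 0) - 1 := by
    intro g
    have := congrArg (Int.cast : ℤ → ZMod p) (hc g)
    push_cast at this
    exact this
  simp only [h3] at h2
  rw [← hF] at h0 h2
  have h4 : F * (F * F) = (n : ZMod p) ^ 2 • F := by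
    rw [h2, hF, sq_conv, smul_sum]
    apply sum_congr rfl
    intro g _
    rw [MonoidAlgebra.smul_single]
    congr 1
    simp only [mul_sub, sum_sub_distrib, mul_one]
    have : ∑ x, (f x : ZMod p) = 0 := by exact_mod_cast congrArg (Int.cast : ℤ → ZMod p) hsum
    rw [this]
    simp only [inv_mul_eq_one, mul_ite, mul_zero, sum_ite_eq', mem_univ, if_true, smul_eq_mul,
      sub_zero]
    ring
  have h5 : ∀ k : ℕ, F ^ (2 * k + 1) = (n : ZMod p) ^ (2 * k) • F := by
    intro k
    induction k with
    | zero => simp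
    | succ k ih =>
      have : F ^ (2 * (k + 1) + 1) = F ^ (2 * k + 1) * (F * F) := by ring
      rw [this, ih, smul_mul_assoc, h4, smul_smul]
      congr 1
      ring
  have h6 : F ^ p = F := by
    obtain ⟨k, hk⟩ := hp.odd_of_ne_two (by omega)
    have h7 : (n : ZMod p) ^ (2 * k) = 1 := by
      have := ZMod.pow_card_sub_one_eq_one (p := p) (a := (n : ZMod p)) (by
        intro h
        rw [ZMod.natCast_eq_zero_iff] at h
        have := Nat.eq_one_of_dvd_coprimes hpn.symm dvd_rfl h
        omega)
      have hk' : p - 1 = 2 * k := by omega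
      rwa [← hk']
    have h8 := h5 k
    rwa [← hk, h7, one_smul] at h8
  rw [h6] at h0
  have h8 : (f (g ^ p) : ZMod p) = (f g : ZMod p) := by
    rw [← h0, hF]
    simp [MonoidAlgebra.coeff_sum, Finsupp.finsetSum_apply, Finsupp.single_apply]
  rw [ZMod.intCast_eq_intCast_iff_dvd_sub] at h8
  have h9 : (2 : ℤ) < p := by exact_mod_cast hp2
  have h10 : f g - f (g ^ p) = 0 := by
    apply Int.eq_zero_of_abs_lt_dvd h8
    rcases hf g with h | h | h <;> rcases hf (g ^ p) with h' | h' | h' <;> rw [h, h'] <;> norm_num <;> linarith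
  linarith

lemma char_conv {A Q : Type*} [AddCommGroup A] [Fintype A] [DecidableEq A]
    [CommGroup Q] [Fintype Q] [DecidableEq Q] (f : A → Q → ℤ) (v : ℤ)
    (hc : ∀ a b, ∑ x, ∑ y, f x y * f (a - x) (y⁻¹ * b) = (if a = 0 ∧ b = 1 then v else 0) - 1)
    (χ : AddChar A ℂ) (hχ : χ ≠ 1) (h : Q → ℤ) (hh : ∀ b, ∑ a, χ a * f a b = h b) (c : Q) :
    ∑ b, h b * h (b⁻¹ * c) = if c = 1 then v else 0 := by
  have key : ∑ b, (h b : ℂ) * (h (b⁻¹ * c) : ℂ) = ∑ a, χ a * ((∑ x, ∑ y, f x y * f (a - x) (y⁻¹ * c) : ℤ) : ℂ) := by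
    simp only [← hh, sum_mul_sum]
    push_cast
    simp only [mul_sum]
    rw [sum_comm (f := fun a x => ∑ y, χ a * ((f x y : ℂ) * (f (a - x) (y⁻¹ * c) : ℂ)))]
    rw [sum_comm]
    apply sum_congr rfl
    intro x _
    rw [sum_comm]
    apply Fintype.sum_equiv (Equiv.addRight x)
    intro a
    apply sum_congr rfl
    intro y _
    simp [AddChar.map_add_eq_mul]
    ring
  simp only [hc] at key
  push_cast at key
  simp only [mul_sub, mul_one, sum_sub_distrib, AddChar.sum_eq_zero_of_ne_one hχ] at key
  by_cases h1 : c = 1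
  · simp [h1] at key ⊢
    exact_mod_cast key
  · simp [h1] at key ⊢
    exact_mod_cast key

structure Good {A Q : Type*} [AddCommGroup A] [Fintype A] [DecidableEq A]
    [CommGroup Q] [Fintype Q] [DecidableEq Q] (f : A → Q → ℤ) : Prop where
  conv : ∀ a b, ∑ x, ∑ y, f x y * f (a - x) (y⁻¹ * b)
    = (if a = 0 ∧ b = 1 then 25 * (Fintype.card Q : ℤ) else 0) - 1
  zero : f 0 1 = 0
  pm : ∀ a b, a ≠ 0 ∨ b ≠ 1 → f a b = 1 ∨ f a b = -1
  symm : ∀ a b, f (-a) b⁻¹ = f a b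
  dbl : ∀ a b, f (a + a) b = f a b
  cop : (Nat.card Q).Coprime 5

lemma Good.pow {A Q : Type*} [CommRing A] [Fintype A] [DecidableEq A]
    [CommGroup Q] [Fintype Q] [DecidableEq Q] {f : A → Q → ℤ} (hf : Good f) (k : ℕ) (a : A) (b : Q) :
    f (2 ^ k * a) b = f a b := by
  induction k with
  | zero => simp
  | succ k ih => rw [← ih, ← hf.dbl (2 ^ k * a)]; congr 1; ring

lemma case25 {Q : Type*} [CommGroup Q] [Fintype Q] [DecidableEq Q] (f : ZMod 25 → Q → ℤ)
    (hf : Good f) : False := by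
  have hdec : ∀ a b, f a b = f 1 b + (f 0 b - f 5 b) * (if a = 0 then 1 else 0)
      + (f 5 b - f 1 b) * (if 5 * a = 0 then 1 else 0) := by
    intro a b
    have : ∀ a : ZMod 25, a = 0 ∨ ∃ k : Fin 20, (a = 2 ^ k.val * 5 ∧ a ≠ 0 ∧ 5 * a = 0) ∨
      (a = 2 ^ k.val * 1 ∧ a ≠ 0 ∧ 5 * a ≠ 0) := by decide +kernel
    rcases this a with h | ⟨k, ⟨h, h0, h1⟩ | ⟨h, h0, h1⟩⟩
    · simp only [h, mul_zero, if_true]; ring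
    · have h2 : f a b = f 5 b := by rw [h, hf.pow]
      rw [if_neg h0, if_pos h1, h2]; ring
    · have h2 : f a b = f 1 b := by rw [h, hf.pow]
      rw [if_neg h0, if_neg h1, h2]; ring
  let χ : AddChar (ZMod 25) ℂ := (ZMod.stdAddChar (N := 25)).mulShift 5
  have hχ1 : χ ≠ 1 := ZMod.isPrimitive_stdAddChar 25 (by decide)
  have hχ : ∀ a, 5 * a = 0 → χ a = 1 := by
    intro a ha
    simp [χ, AddChar.mulShift_apply, ha]
  have hh : ∀ b, ∑ a, χ a * f a b = ((f 0 b + 4 * f 5 b - 5 * f 1 b : ℤ) : ℂ) := by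
    intro b
    have h1 : ∀ a, χ a * f a b = f 1 b * χ a + (f 0 b - f 5 b : ℂ) * (if a = 0 then 1 else 0)
      + (f 5 b - f 1 b : ℂ) * (if 5 * a = 0 then 1 else 0) := by
      intro a
      rw [hdec a b]
      push_cast
      by_cases h' : 5 * a = 0
      · rw [hχ a h']; simp only [h', if_true]; ring
      · have h : a ≠ 0 := by rintro rfl; simp at h'
        simp only [h, h', if_false]; ring
    have h5 : ∑ a : ZMod 25, (if 5 * a = 0 then (1 : ℂ) else 0) = 5 := by
      rw [sum_boole]
      have : (univ.filter (fun a : ZMod 25 => 5 * a = 0)).card = 5 := by decide +kernel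
      rw [this]; norm_num
    simp only [h1, sum_add_distrib, ← mul_sum, h5, AddChar.sum_eq_zero_of_ne_one hχ1]
    simp
    ring
  have hd := mod5 hf.cop _ _ (char_conv f _ hf.conv χ hχ1 _ hh) 1
  simp only [hf.zero] at hd
  rcases hf.pm 5 1 (Or.inl (by decide)) with h | h <;> rw [h] at hd <;> omega

def wv : Fin 6 → ZMod 5 × ZMod 5 := ![(1, 0), (1, 1), (1, 2), (1, 3), (1, 4), (0, 1)]

def bf (a b : ZMod 5 × ZMod 5) : ZMod 5 := a.1 * b.2 - a.2 * b.1

lemma wv_sum (i : Fin 6) (g : ZMod 5 × ZMod 5 → ℂ) :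
    ∑ a, (if bf (wv i) a = 0 then g a else 0) = ∑ t : ZMod 5, g (t * (wv i).1, t * (wv i).2) := by
  rw [← sum_filter]
  have h1 : ∀ i, univ.filter (fun a => bf (wv i) a = 0)
      = univ.image (fun t : ZMod 5 => (t * (wv i).1, t * (wv i).2)) := by decide +kernel
  have h2 : ∀ i, Function.Injective (fun t : ZMod 5 => (t * (wv i).1, t * (wv i).2)) := by
    unfold Function.Injective; decide +kernel
  rw [h1, sum_image (fun x _ y _ h => h2 i h)]

def bfHom (u : ZMod 5 × ZMod 5) : ZMod 5 × ZMod 5 →+ ZMod 5 where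
  toFun := bf u
  map_zero' := by simp [bf]
  map_add' := by intro x y; simp [bf]; ring

noncomputable def chi (j : Fin 6) : AddChar (ZMod 5 × ZMod 5) ℂ :=
  (ZMod.stdAddChar (N := 5)).compAddMonoidHom (bfHom (wv j))

lemma chi_apply (j : Fin 6) (a) : chi j a = ZMod.stdAddChar (bf (wv j) a) := rfl

lemma chi_sum (i j : Fin 6) :
    ∑ a, (if bf (wv i) a = 0 then chi j a else 0) = if i = j then 5 else 0 := by
  rw [wv_sum]
  have h := AddChar.sum_mulShift (bf (wv j) (wv i)) (ZMod.isPrimitive_stdAddChar 5)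
  have h0 : ∀ i j, bf (wv j) (wv i) = 0 ↔ i = j := by clear * -; decide +kernel
  simp only [h0, ZMod.card] at h
  push_cast at h
  rw [← h]
  apply sum_congr rfl
  intro t _
  rw [chi_apply]
  congr 1
  simp [bf]; ring

lemma chi_ne (j : Fin 6) : chi j ≠ 1 := by
  intro h
  have h1 : ∃ i : Fin 6, i ≠ j := by clear h; revert j; decide
  obtain ⟨i, hi⟩ := h1
  have h2 := chi_sum i j
  rw [if_neg hi, h, wv_sum] at h2
  simp at h2

lemma arith (x0 : ℤ) (x : Fin 6 → ℤ) (hx : ∀ i, x i = 1 ∨ x i = -1)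
    (h5 : (5 : ℤ) ∣ x0 - ∑ i, x i + 5 * x 0) :
    (x0 = 0 → ∑ j, (x0 - ∑ i, x i + 5 * x j) ^ 2 ≤ 150) ∧
    (x0 = 1 ∨ x0 = -1 → ∑ j, (x0 - ∑ i, x i + 5 * x j) ^ 2 ≤ 100) := by
  have e0 := hx 0
  have e1 := hx 1
  have e2 := hx 2
  have e3 := hx 3
  have e4 := hx 4
  have e5 := hx 5
  simp only [Fin.sum_univ_six] at *
  generalize x 0 = y0 at *
  generalize x 1 = y1 at *
  generalize x 2 = y2 at *
  generalize x 3 = y3 at *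
  generalize x 4 = y4 at *
  generalize x 5 = y5 at *
  clear hx
  constructor
  · rintro rfl
    rcases e0 with rfl | rfl <;> rcases e1 with rfl | rfl <;> rcases e2 with rfl | rfl <;>
      rcases e3 with rfl | rfl <;> rcases e4 with rfl | rfl <;> rcases e5 with rfl | rfl <;>
      revert h5 <;> decide
  · rintro (rfl | rfl) <;>
    rcases e0 with rfl | rfl <;> rcases e1 with rfl | rfl <;> rcases e2 with rfl | rfl <;>
      rcases e3 with rfl | rfl <;> rcases e4 with rfl | rfl <;> rcases e5 with rfl | rfl <;>
      revert h5 <;> decide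

lemma case55 {Q : Type*} [CommGroup Q] [Fintype Q] [DecidableEq Q] (f : ZMod 5 × ZMod 5 → Q → ℤ)
    (hf : Good f) (hQ : 1 < Fintype.card Q) : False := by
  have hdec : ∀ a b, f a b = (f 0 b - ∑ i, f (wv i) b) * (if a = 0 then 1 else 0)
      + ∑ i, f (wv i) b * (if bf (wv i) a = 0 then 1 else 0) := by
    intro a b
    by_cases ha : a = 0
    · simp [ha, bf]
    · have : ∀ a : ZMod 5 × ZMod 5, a ≠ 0 → ∃ i : Fin 6, ∃ k : Fin 4, a = 2 ^ k.val * wv i ∧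
        ∀ j, bf (wv j) a = 0 ↔ j = i := by decide +kernel
      obtain ⟨i, k, h1, h2⟩ := this a ha
      have h3 : f a b = f (wv i) b := by rw [h1, hf.pow]
      simp [h2, ha, h3]
  let h : Fin 6 → Q → ℤ := fun j b => f 0 b - ∑ i, f (wv i) b + 5 * f (wv j) b
  have hh : ∀ j b, ∑ a, chi j a * f a b = (h j b : ℂ) := by
    intro j b
    have h1 : ∀ a, chi j a * f a b = (f 0 b - ∑ i, f (wv i) b : ℂ) * (if a = 0 then 1 else 0)
      + ∑ i, (f (wv i) b : ℂ) * (if bf (wv i) a = 0 then chi j a else 0) := by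
      intro a
      rw [hdec a b]
      push_cast
      rw [mul_add, mul_sum]
      congr 1
      · by_cases ha : a = 0
        · simp [ha]
        · simp [ha]
      · apply sum_congr rfl
        intro i _
        split_ifs <;> simp [mul_comm]
    simp only [h1, sum_add_distrib]
    rw [sum_comm]
    simp only [← mul_sum, chi_sum]
    simp [h]
    ring
  have hcv := fun j => char_conv f _ hf.conv (chi j) (chi_ne j) (h j) (hh j)
  have hd := fun j => mod5 hf.cop _ _ (hcv j)
  have hinv : ∀ a b, f a b⁻¹ = f a b := by
    intro a b
    rw [← hf.symm a b]
    have := hf.pow 2 (-a) b⁻¹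
    rw [← this]
    congr 1
    clear this; revert a; clear * -; decide +kernel
  have hhinv : ∀ j b, h j b⁻¹ = h j b := by
    intro j b; simp only [h, hinv]
  have hs : ∀ j, ∑ b, (h j b) ^ 2 = 25 * (Fintype.card Q : ℤ) := by
    intro j
    have := hcv j 1
    simp only [mul_one, hhinv, if_true] at this
    rw [← this]
    exact sum_congr rfl fun b _ => sq _
  have hw : ∀ i, wv i ≠ 0 := by decide
  have hb : ∀ b, ∑ j, (h j b) ^ 2 ≤ 100 + (if b = 1 then 50 else 0) := by
    intro b
    have ar := arith (f 0 b) (fun i => f (wv i) b) (fun i => hf.pm _ _ (Or.inl (hw i))) (hd 0 b)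
    by_cases hb1 : b = 1
    · rw [if_pos hb1]
      exact ar.1 (by rw [hb1]; exact hf.zero)
    · rw [if_neg hb1]
      exact ar.2 (hf.pm _ _ (Or.inr hb1))
  have h1 : ∑ b, ∑ j, (h j b) ^ 2 = 150 * (Fintype.card Q : ℤ) := by
    rw [sum_comm]
    simp only [hs]
    simp
    ring
  have h2 : ∑ b, ∑ j, (h j b) ^ 2 ≤ ∑ b : Q, (100 + (if b = 1 then 50 else 0) : ℤ) :=
    sum_le_sum fun b _ => hb b
  rw [h1, sum_add_distrib] at h2
  simp at h2
  omega

lemma good_of {G A Q : Type*} [CommGroup G] [Fintype G] [DecidableEq G]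
    [AddCommGroup A] [Fintype A] [DecidableEq A] [CommGroup Q] [Fintype Q] [DecidableEq Q]
    (e : Multiplicative A × Q ≃* G) (q : ℕ) (hA : Fintype.card A = 25)
    (hQ : Fintype.card Q = q ^ 2) (hG : Fintype.card G = 25 * q ^ 2) (hq : q.Coprime 5)
    (f : G → ℤ) (h1 : f 1 = 0) (hpm : ∀ g, g ≠ 1 → f g = 1 ∨ f g = -1) (hs : ∀ g, f g⁻¹ = f g)
    (hc : ∀ g, ∑ x, f x * f (x⁻¹ * g) = (if g = 1 then (Fintype.card G : ℤ) else 0) - 1) :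
    Good (fun a b => f (e (Multiplicative.ofAdd a, b))) := by
  have hq0 : q ≠ 0 := by
    rintro rfl
    have := Fintype.card_pos (α := Q)
    omega
  have hcop : (25 : ℕ).Coprime (q ^ 2) := by
    have : (5 ^ 2 : ℕ).Coprime (q ^ 2) := Nat.Coprime.pow 2 2 hq.symm
    simpa using this
  constructor
  · intro a b
    have := hc (e (Multiplicative.ofAdd a, b))
    rw [← e.toEquiv.sum_comp, Fintype.sum_prod_type] at this
    have h2 : (e (Multiplicative.ofAdd a, b) = 1) ↔ (a = 0 ∧ b = 1) := by
      rw [e.map_eq_one_iff, Prod.mk_eq_one, ofAdd_eq_one]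
    simp only [h2, hG] at this
    rw [hQ]
    push_cast at this ⊢
    rw [← this]
    apply Fintype.sum_equiv Multiplicative.ofAdd
    intro x
    apply sum_congr rfl
    intro y _
    congr 1
    change _ = f ((e (Multiplicative.ofAdd x, y))⁻¹ * e (Multiplicative.ofAdd a, b))
    rw [← map_inv, ← map_mul]
    congr 2
    ext
    · change a - x = -x + a
      abel
    · rfl
  · change f (e 1) = 0
    simp [h1]
  · intro a b hab
    apply hpm
    rw [Ne, e.map_eq_one_iff, Prod.mk_eq_one, ofAdd_eq_one]
    tauto
  · intro a b
    rw [← hs (e (Multiplicative.ofAdd a, b)), ← map_inv]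
    rfl
  · obtain ⟨r, hr1, hr2⟩ := Nat.chineseRemainder hcop 2 1
    have hrc : r.Coprime (25 * q ^ 2) := by
      apply Nat.Coprime.mul_right
      · rw [Nat.Coprime, hr1.gcd_eq]; rfl
      · rw [Nat.Coprime, hr2.gcd_eq]; simp
    obtain ⟨p, hp2, hp, hpr⟩ := Nat.forall_exists_prime_gt_and_modEq 2 (by positivity) hrc
    have hp25 : p ≡ 2 [MOD 25] := (hpr.of_mul_right _).trans hr1
    have hpq : p ≡ 1 [MOD q ^ 2] := (hpr.of_mul_left _).trans hr2
    have hpc : p.Coprime (25 * q ^ 2) := by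
      rw [Nat.Coprime, hpr.gcd_eq]; exact hrc
    have hpn : (5 * q).Coprime p := by
      apply Nat.Coprime.symm
      apply Nat.Coprime.coprime_dvd_right _ hpc
      exact ⟨5 * q, by ring⟩
    have hm := mult (5 * q) (by rw [hG]; ring) f (fun g => by
      by_cases hg : g = 1
      · left; rw [hg, h1]
      · right; exact hpm g hg) (fun g => by
        rw [hc, hG]; push_cast
        congr 2
        ring) p hp hp2 hpn
    intro a b
    change f (e (Multiplicative.ofAdd (a + a), b)) = f (e (Multiplicative.ofAdd a, b))
    rw [← hm (e (Multiplicative.ofAdd a, b)), ← map_pow]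
    congr 2
    ext
    · change a + a = p • a
      rw [← two_nsmul]
      have ho : addOrderOf a ∣ 25 := hA ▸ addOrderOf_dvd_card
      exact ((nsmul_eq_nsmul_iff_modEq).2 (hp25.of_dvd ho)).symm
    · change b = b ^ p
      have ho : orderOf b ∣ q ^ 2 := hQ ▸ orderOf_dvd_card
      have := (pow_eq_pow_iff_modEq (x := b)).2 (hpq.of_dvd ho)
      rw [this, pow_one]
  · rw [Nat.card_eq_fintype_card, hQ]
    exact hq.pow_left 2

lemma card25 (P : Type*) [CommGroup P] [Fintype P] (hP : Fintype.card P = 25) :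
    Nonempty (Multiplicative (ZMod 25) ≃* P) ∨
    Nonempty (Multiplicative (ZMod 5 × ZMod 5) ≃* P) := by
  by_cases hc : IsCyclic P
  · left
    have e := zmodCyclicMulEquiv hc
    rw [Nat.card_eq_fintype_card, hP] at e
    exact ⟨e⟩
  · right
    have : Fact (Nat.Prime 5) := ⟨by norm_num⟩
    have h1 : Monoid.exponent P ∣ 5 ^ 2 := by
      have := Group.exponent_dvd_nat_card (G := P)
      rwa [Nat.card_eq_fintype_card, hP] at this
    have h2 : Monoid.exponent P ≠ 25 := by
      intro h
      apply hc
      apply IsCyclic.of_exponent_eq_card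
      rw [h, Nat.card_eq_fintype_card, hP]
    have h3 : Monoid.exponent P ∣ 5 := by
      obtain ⟨k, hk, hk'⟩ := (Nat.dvd_prime_pow (by norm_num)).1 h1
      interval_cases k
      · rw [hk']; norm_num
      · rw [hk']; norm_num
      · exact absurd hk' h2
    let _ : Module (ZMod 5) (Additive P) := AddCommGroup.zmodModule (by
      intro x
      exact Monoid.exponent_dvd_iff_forall_pow_eq_one.1 h3 x.toMul)
    have h4 : Module.finrank (ZMod 5) (Additive P) = 2 := by
      have := Module.card_eq_pow_finrank (K := ZMod 5) (V := Additive P)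
      rw [Fintype.card_additive, hP, ZMod.card] at this
      exact (Nat.pow_right_injective (le_refl 2 |>.trans (by norm_num : 2 ≤ 5)) (by simpa using this : 5 ^ 2 = 5 ^ _)).symm
    have e : (ZMod 5 × ZMod 5) ≃ₗ[ZMod 5] Additive P := LinearEquiv.ofFinrankEq _ _ (by simp [h4])
    exact ⟨AddEquiv.toMultiplicativeLeft e.toAddEquiv⟩

/-- For `q` odd, `q > 1`, `gcd(5, q) = 1`, there is no regular Paley type PDS in any
abelian group of order `25 q²`. -/
theorem stmt9 (q : ℕ) (hq : Odd q) (hq1 : 1 < q) (hgcd : Nat.gcd 5 q = 1)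
    (hG : Fintype.card G = 25 * q ^ 2) (D : Finset G) :
    ¬ IsPaleyPDS D := by
  rintro ⟨k, l, m, ⟨⟨-, hk, hl, hm⟩, hs, h1D⟩, e1, e2, e3⟩
  classical
  have : Fact (Nat.Prime 5) := ⟨by norm_num⟩
  have hq5 : q.Coprime 5 := Nat.Coprime.symm hgcd
  have hcop : (25 : ℕ).Coprime (q ^ 2) := by
    have : (5 ^ 2 : ℕ).Coprime (q ^ 2) := Nat.Coprime.pow 2 2 hq5.symm
    simpa using this
  obtain ⟨P, hP⟩ := Sylow.exists_subgroup_card_pow_prime (G := G) 5 (n := 2)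
    (by rw [Nat.card_eq_fintype_card, hG]; exact ⟨q ^ 2, by ring⟩)
  have hi : P.index = q ^ 2 := by
    have := P.card_mul_index
    rw [hP, Nat.card_eq_fintype_card, hG] at this
    omega
  obtain ⟨Q, hPQ⟩ := Subgroup.exists_right_complement'_of_coprime (N := P)
    (by rw [hP, hi]; exact hcop)
  have hQ : Fintype.card Q = q ^ 2 := by
    have := hPQ.card_mul_card
    rw [hP, Nat.card_eq_fintype_card, Nat.card_eq_fintype_card, hG] at this
    omega
  have hP' : Fintype.card P = 25 := by
    rw [← Nat.card_eq_fintype_card, hP]; norm_num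
  let e0 : P × Q ≃* G := MulEquiv.ofBijective (MonoidHom.coprod P.subtype Q.subtype) hPQ
  let f : G → ℤ := fun g => 2 * (if g ∈ D then 1 else 0) + (if g = 1 then 1 else 0) - 1
  have hc := conv0 D _ k l m rfl hk hl hm hs h1D e1 e2 e3 f (fun _ => rfl)
  have f1 : f 1 = 0 := by simp [f, h1D]
  have fpm : ∀ g, g ≠ 1 → f g = 1 ∨ f g = -1 := by
    intro g hg
    by_cases h : g ∈ D <;> simp [f, hg, h]
  have fs : ∀ g, f g⁻¹ = f g := by
    intro g
    simp [f, ← hs]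
  have hQ1 : 1 < Fintype.card Q := by rw [hQ]; exact Nat.one_lt_pow (by norm_num) hq1
  rcases card25 P hP' with ⟨⟨e⟩⟩ | ⟨⟨e⟩⟩
  · exact case25 _ (good_of ((e.prodCongr (MulEquiv.refl Q)).trans e0) q (by simp [ZMod.card]) hQ hG hq5 f f1 fpm fs hc)
  · exact case55 _ (good_of ((e.prodCongr (MulEquiv.refl Q)).trans e0) q (by simp [ZMod.card]) hQ hG hq5 f f1 fpm fs hc) hQ1
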